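/- arXiv:2510.23335 — 8 statements merged into one kernel-verified Lean document; each statement's English description precedes it below -/
import Mathlib

section
/- Consider a totally separable MDP in which, for each action a, the constant-policy matrix P_a is irreducible with invariant distribution μ_a. Then the constant policy π*(s) = a* for all s, where a* ∈ argmax_{a∈A} [Σ_s μ_a(s) r_S(s) + r_A(a)], is average-optimal among all stationary policies: for every stationary policy π : S → A and every invariant distribution μ of the induced matrix P_π, one has Σ_s μ(s) (r_S(s) + r_A(π(s))) ≤ max_{a∈A} [Σ_s μ_a(s) r_S(s) + r_A(a)], and the constant policy π* attains this value, i.e. Σ_s μ_{a*}(s) (r_S(s) + r_A(a*)) = max_{a∈A} [Σ_s μ_a(s) r_S(s) + r_A(a)]. -/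
open Finset

/-- A row-stochastic matrix on a finite set `S`. -/
def RowStochastic {S : Type} [Fintype S] (P : Matrix S S ℝ) : Prop :=
  (∀ s s', 0 ≤ P s s') ∧ ∀ s, ∑ s', P s s' = 1

/-- Irreducibility: for all `s, s'` there is `n ≥ 1` with `(P^n) s s' > 0`. -/
def IrreducibleMat {S : Type} [Fintype S] [DecidableEq S] (P : Matrix S S ℝ) : Prop :=
  ∀ s s', ∃ n : ℕ, 1 ≤ n ∧ 0 < (P ^ n) s s'

/-- `μ` is an invariant (stationary) probability distribution of `P`. -/
def InvariantDist {S : Type} [Fintype S] (μ : S → ℝ) (P : Matrix S S ℝ) : Prop :=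
  (∀ s, 0 ≤ μ s) ∧ (∑ s, μ s = 1) ∧ ∀ s', ∑ s, μ s * P s s' = μ s'

/-- **Theorem 1 (optimality part), totally separable MDP.**
The constant policy `π* ≡ a*`, where `a*` attains
`max_{a} [Σ_s μ_a(s) r_S(s) + r_A(a)]`, is average-optimal among all
stationary policies, and it attains this maximal value. -/
theorem totally_separable_constant_policy_optimal
    {S A : Type} [Fintype S] [DecidableEq S] [Nonempty S] [Fintype A] [Nonempty A]
    (rS : S → ℝ) (rA : A → ℝ) (PA : A → S → ℝ)
    (hPA : ∀ a, (∀ s', 0 ≤ PA a s') ∧ ∑ s', PA a s' = 1)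
    (μ : A → S → ℝ)
    (hirr : ∀ a, IrreducibleMat (Matrix.of fun _ s' => PA a s'))
    (hinv : ∀ a, InvariantDist (μ a) (Matrix.of fun _ s' => PA a s'))
    (astar : A)
    (hastar : (∑ s, μ astar s * rS s) + rA astar =
      Finset.univ.sup' Finset.univ_nonempty (fun a => (∑ s, μ a s * rS s) + rA a)) :
    (∀ (π : S → A) (ν : S → ℝ),
        InvariantDist ν (Matrix.of fun s s' => PA (π s) s') →
        ∑ s, ν s * (rS s + rA (π s)) ≤
          Finset.univ.sup' Finset.univ_nonempty (fun a => (∑ s, μ a s * rS s) + rA a)) ∧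
    (∑ s, μ astar s * (rS s + rA astar)) =
      Finset.univ.sup' Finset.univ_nonempty (fun a => (∑ s, μ a s * rS s) + rA a) := by
  have hμ : ∀ a s, μ a s = PA a s := by
    intro a s
    have h := (hinv a).2.2 s
    simp only [Matrix.of_apply] at h
    rw [← Finset.sum_mul, (hinv a).2.1, one_mul] at h
    exact h.symm
  refine ⟨?_, ?_⟩
  · intro π ν hν
    obtain ⟨h0, h1, h2⟩ := hν
    simp only [Matrix.of_apply] at h2
    set M := Finset.univ.sup' Finset.univ_nonempty
      (fun a => (∑ s, μ a s * rS s) + rA a) with hM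
    have hle : ∀ a, (∑ s, μ a s * rS s) + rA a ≤ M := fun a =>
      Finset.le_sup' (fun a => (∑ s, μ a s * rS s) + rA a) (Finset.mem_univ a)
    have e1 : ∑ s, ν s * rS s = ∑ s, ν s * ∑ s', μ (π s) s' * rS s' := by
      calc ∑ s, ν s * rS s = ∑ s', (∑ s, ν s * PA (π s) s') * rS s' := by
            simp only [h2]
        _ = ∑ s', ∑ s, ν s * (PA (π s) s' * rS s') := by
            simp only [Finset.sum_mul, mul_assoc]
        _ = _ := by
            rw [Finset.sum_comm]
            simp only [Finset.mul_sum, hμ]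
    calc ∑ s, ν s * (rS s + rA (π s))
        = ∑ s, ν s * ((∑ s', μ (π s) s' * rS s') + rA (π s)) := by
          simp only [mul_add, Finset.sum_add_distrib, e1]
      _ ≤ ∑ s, ν s * M :=
          Finset.sum_le_sum fun s _ => mul_le_mul_of_nonneg_left (hle (π s)) (h0 s)
      _ = M := by rw [← Finset.sum_mul, h1, one_mul]
  · rw [← hastar]
    simp only [mul_add, Finset.sum_add_distrib]
    rw [← Finset.sum_mul, (hinv astar).2.1, one_mul]
end

section
/- Consider a totally separable MDP in which, for each action a, the constant-policy matrix P_a is irreducible with invariant distribution μ_a, and let g* = max_{a∈A} [Σ_s μ_a(s) r_S(s) + r_A(a)]. Then there exists a bias function h : S → ℝ such that the pair (g*, h) satisfies the average-cost optimality equation exactly: for every state s, g* + h(s) = max_{a∈A} [ r_S(s) + r_A(a) + Σ_{s'} P_A(s'|a) h(s') ]. -/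
open Finset

/-- **Theorem 1 (ACOE part), totally separable MDP.**
With `g* = max_a [Σ_s μ_a(s) r_S(s) + r_A(a)]`, there exists a bias `h` such
that `(g*, h)` satisfies the average-cost optimality equation exactly. -/
theorem totally_separable_ACOE
    {S A : Type} [Fintype S] [DecidableEq S] [Nonempty S] [Fintype A] [Nonempty A]
    (rS : S → ℝ) (rA : A → ℝ) (PA : A → S → ℝ)
    (hPA : ∀ a, (∀ s', 0 ≤ PA a s') ∧ ∑ s', PA a s' = 1)
    (μ : A → S → ℝ)
    (hirr : ∀ a, IrreducibleMat (Matrix.of fun _ s' => PA a s'))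
    (hinv : ∀ a, InvariantDist (μ a) (Matrix.of fun _ s' => PA a s')) :
    ∃ h : S → ℝ, ∀ s : S,
      (Finset.univ.sup' Finset.univ_nonempty (fun a => (∑ s', μ a s' * rS s') + rA a)) + h s =
        Finset.univ.sup' Finset.univ_nonempty
          (fun a => rS s + rA a + ∑ s', PA a s' * h s') := by
  have hμ : ∀ a s, μ a s = PA a s := by
    intro a s
    obtain ⟨_, h1, h2⟩ := hinv a
    have := h2 s
    simp only [Matrix.of_apply] at this
    rw [← Finset.sum_mul, h1, one_mul] at this
    exact this.symm
  refine ⟨rS, fun s => ?_⟩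
  simp only [hμ]
  apply le_antisymm
  · rw [← le_sub_iff_add_le]
    refine Finset.sup'_le _ _ fun a _ => ?_
    have := Finset.le_sup' (fun a => rS s + rA a + ∑ s', PA a s' * rS s') (Finset.mem_univ a)
    linarith
  · refine Finset.sup'_le _ _ fun a _ => ?_
    have := Finset.le_sup' (fun a => (∑ s', PA a s' * rS s') + rA a) (Finset.mem_univ a)
    linarith
end

section
/- Let S be a finite nonempty set, let P be an irreducible row-stochastic matrix on S with invariant distribution μ, and let f : S → ℝ satisfy Σ_s μ(s) f(s) = 0. Then the Poisson equation is solvable: there exists h : S → ℝ such that for every s, h(s) − Σ_{s'} P(s,s') h(s') = f(s). -/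
open Finset

lemma pow_fix {S : Type} [Fintype S] [DecidableEq S] (P : Matrix S S ℝ) (h : S → ℝ)
    (hh : P.mulVec h = h) (n : ℕ) : (P ^ n).mulVec h = h := by
  induction n with
  | zero => simp
  | succ k ih => rw [pow_succ, ← Matrix.mulVec_mulVec, hh, ih]

lemma pow_nn {S : Type} [Fintype S] [DecidableEq S] (P : Matrix S S ℝ)
    (hP : ∀ s s', 0 ≤ P s s') (n : ℕ) : ∀ s s', 0 ≤ (P ^ n) s s' := by
  induction n with
  | zero =>
    intro s s'
    rw [pow_zero, Matrix.one_apply]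
    split_ifs <;> norm_num
  | succ k ih =>
    intro s s'
    rw [pow_succ, Matrix.mul_apply]
    exact Finset.sum_nonneg fun t _ => mul_nonneg (ih _ _) (hP _ _)

lemma harmonic_const {S : Type} [Fintype S] [DecidableEq S] [Nonempty S]
    (P : Matrix S S ℝ) (hP : RowStochastic P) (hirr : IrreducibleMat P) (h : S → ℝ)
    (hh : P.mulVec h = h) : ∃ c, ∀ s, h s = c := by
  obtain ⟨s0, hs0⟩ := Finite.exists_max h
  refine ⟨h s0, fun s => ?_⟩
  obtain ⟨n, -, hn⟩ := hirr s0 s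
  have h1 : P.mulVec (fun _ => (1 : ℝ)) = fun _ => 1 := by
    funext t
    simpa [Matrix.mulVec, dotProduct] using hP.2 t
  have e1 := congrFun (pow_fix P _ h1 n) s0
  have e2 := congrFun (pow_fix P _ hh n) s0
  simp only [Matrix.mulVec, dotProduct, mul_one] at e1 e2
  have e3 : ∑ t, (P ^ n) s0 t * (h s0 - h t) = 0 := by
    simp only [mul_sub, Finset.sum_sub_distrib, ← Finset.sum_mul]
    rw [e1, e2]; ring
  have e4 := (Finset.sum_eq_zero_iff_of_nonneg (fun t _ =>
    mul_nonneg (pow_nn P hP.1 n s0 t) (sub_nonneg.2 (hs0 t)))).1 e3 s (Finset.mem_univ s)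
  rcases mul_eq_zero.1 e4 with h | h <;> linarith

/-- **Solvability of the Poisson equation** for an irreducible row-stochastic
matrix `P` with invariant distribution `μ`, when `f` has zero mean under `μ`. -/
theorem poisson_equation_solvable
    {S : Type} [Fintype S] [DecidableEq S] [Nonempty S]
    (P : Matrix S S ℝ) (μ : S → ℝ) (f : S → ℝ)
    (hP : RowStochastic P) (hirr : IrreducibleMat P) (hinv : InvariantDist μ P)
    (hf : ∑ s, μ s * f s = 0) :
    ∃ h : S → ℝ, ∀ s, h s - ∑ s', P s s' * h s' = f s := by
  obtain ⟨hm0, hm1, hm⟩ := hinv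
  let T : (S → ℝ) →ₗ[ℝ] (S → ℝ) :=
    { toFun := fun h s => h s - ∑ s', P s s' * h s' + ∑ t, μ t * h t
      map_add' := by
        intro a b
        funext s
        simp only [Pi.add_apply, mul_add, Finset.sum_add_distrib]
        ring
      map_smul' := by
        intro c a
        funext s
        simp only [Pi.smul_apply, smul_eq_mul, RingHom.id_apply, mul_left_comm _ c,
          ← Finset.mul_sum]
        ring }
  have hT : ∀ h s, T h s = h s - ∑ s', P s s' * h s' + ∑ t, μ t * h t := fun _ _ => rfl
  have key : ∀ h, ∑ s, μ s * T h s = ∑ t, μ t * h t := by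
    intro h
    have e : ∑ s, μ s * ∑ s', P s s' * h s' = ∑ t, μ t * h t := by
      simp only [Finset.mul_sum]
      rw [Finset.sum_comm]
      refine Finset.sum_congr rfl fun t _ => ?_
      rw [← hm t, Finset.sum_mul]
      exact Finset.sum_congr rfl fun s _ => by ring
    simp only [hT, mul_add, mul_sub, Finset.sum_add_distrib, Finset.sum_sub_distrib]
    rw [e, ← Finset.sum_mul, hm1]
    ring
  have inj : Function.Injective T := by
    rw [injective_iff_map_eq_zero]
    intro h h0
    have k := key h
    simp only [h0, Pi.zero_apply, mul_zero, Finset.sum_const_zero] at k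
    have hh : P.mulVec h = h := by
      funext s
      have := hT h s
      rw [h0, ← k, Pi.zero_apply] at this
      simp only [Matrix.mulVec, dotProduct]
      linarith
    obtain ⟨c, hc⟩ := harmonic_const P hP hirr h hh
    simp only [hc, ← Finset.sum_mul, hm1, one_mul] at k
    funext s
    rw [hc s, ← k, Pi.zero_apply]
  obtain ⟨h, hh⟩ := (LinearMap.injective_iff_surjective.1 inj) f
  refine ⟨h, fun s => ?_⟩
  have k := key h
  rw [hh, hf] at k
  have := hT h s
  rw [hh, ← k] at this
  linarith
end

section
/- Let S be a finite nonempty set and let P be an irreducible row-stochastic matrix on S. If h : S → ℝ satisfies h(s) = Σ_{s'} P(s,s') h(s') for every s, then h is constant. Consequently, any two solutions of the Poisson equation h − P h = f differ by an additive constant. -/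
open Finset

theorem harmonic_const_aux {S : Type} [Fintype S] [DecidableEq S] [Nonempty S]
    (P : Matrix S S ℝ) (hP : RowStochastic P) (hirr : IrreducibleMat P)
    (h : S → ℝ) (hh : ∀ s, h s = ∑ s', P s s' * h s') : ∃ c : ℝ, ∀ s, h s = c := by
  have hmem : P ∈ Matrix.rowStochastic ℝ S := Matrix.mem_rowStochastic_iff_sum.2 hP
  have hpow : ∀ n : ℕ, (P ^ n).mulVec h = h := by
    intro n
    induction n with
    | zero => simp
    | succ k ih =>
      have h1 : P.mulVec h = h := by
        funext s
        exact (hh s).symm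
      rw [pow_succ, ← Matrix.mulVec_mulVec, h1, ih]
  obtain ⟨m, hm⟩ := Finite.exists_max h
  refine ⟨h m, fun s => ?_⟩
  obtain ⟨n, -, hn⟩ := hirr m s
  have hn' : P ^ n ∈ Matrix.rowStochastic ℝ S := pow_mem hmem n
  have e1 : ∑ t, (P ^ n) m t * h t = h m := congrFun (hpow n) m
  have e2 : ∑ t, (P ^ n) m t = 1 := Matrix.sum_row_of_mem_rowStochastic hn' m
  have e3 : ∑ t, (P ^ n) m t * (h m - h t) = 0 := by
    simp only [mul_sub, Finset.sum_sub_distrib, ← Finset.sum_mul, e1, e2]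
    ring
  have e4 := (Finset.sum_eq_zero_iff_of_nonneg (fun t _ =>
    mul_nonneg (Matrix.nonneg_of_mem_rowStochastic hn') (sub_nonneg.2 (hm t)))).1 e3 s
    (Finset.mem_univ s)
  rcases mul_eq_zero.1 e4 with h0 | h0 <;> linarith

/-- **Harmonic functions of an irreducible stochastic matrix are constant**, and
consequently any two solutions of the Poisson equation differ by a constant. -/
theorem harmonic_constant_and_poisson_uniqueness
    {S : Type} [Fintype S] [DecidableEq S] [Nonempty S]
    (P : Matrix S S ℝ) (hP : RowStochastic P) (hirr : IrreducibleMat P) :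
    (∀ h : S → ℝ, (∀ s, h s = ∑ s', P s s' * h s') → ∃ c : ℝ, ∀ s, h s = c) ∧
    (∀ (f h₁ h₂ : S → ℝ),
      (∀ s, h₁ s - ∑ s', P s s' * h₁ s' = f s) →
      (∀ s, h₂ s - ∑ s', P s s' * h₂ s' = f s) →
      ∃ c : ℝ, ∀ s, h₁ s = h₂ s + c) := by
  refine ⟨harmonic_const_aux P hP hirr, fun f h₁ h₂ H₁ H₂ => ?_⟩
  obtain ⟨c, hc⟩ := harmonic_const_aux P hP hirr (fun s => h₁ s - h₂ s) (fun s => by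
    simp only [mul_sub, Finset.sum_sub_distrib]
    linarith [H₁ s, H₂ s])
  exact ⟨c, fun s => by linarith [hc s]⟩
end

section
/- Consider an ε-perturbed nearly separable MDP in which the unperturbed induced matrix P_π^0 is irreducible for every stationary policy π, and let π*(s) = a* for all s, where a* maximizes a ↦ Σ_s μ_a(s) r_S(s) + r_A(a) over A (μ_a being the invariant distribution of the constant-policy matrix P_a). Then there exist constants C > 0 and ε₀ > 0 such that for all ε with 0 ≤ ε < ε₀: each perturbed matrix P_π^ε is row-stochastic, and for every stationary policy π, every invariant distribution μ of P_π^ε, and every invariant distribution ν of P_{π*}^ε, one has Σ_s μ(s) r^ε(s, π(s)) ≤ Σ_s ν(s) r^ε(s, a*) + C·ε; that is, π* is O(ε)-optimal in the perturbed MDP. -/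
open Finset

lemma nsep_rewrite {S A : Type} [Fintype S] (rS : S → ℝ) (rA : A → ℝ) (PA : A → S → ℝ)
    (rE : S → A → ℝ) (Q : S → A → S → ℝ) (ε : ℝ) (π : S → A) (m : S → ℝ)
    (h : InvariantDist m (Matrix.of fun s s' => PA (π s) s' + ε * Q s (π s) s')) :
    ∑ s, m s * (rS s + rA (π s) + ε * rE s (π s)) =
      ∑ s, m s * (((∑ s', PA (π s) s' * rS s') + rA (π s)) +
        ε * ((∑ s', Q s (π s) s' * rS s') + rE s (π s))) := by
  have h3 := h.2.2
  simp only [Matrix.of_apply] at h3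
  have key : ∑ s, m s * rS s =
      ∑ s, m s * ((∑ s', PA (π s) s' * rS s') + ε * ∑ s', Q s (π s) s' * rS s') := by
    calc ∑ s, m s * rS s
        = ∑ s', (∑ s, m s * (PA (π s) s' + ε * Q s (π s) s')) * rS s' := by
          simp only [h3]
      _ = ∑ s', ∑ s, m s * (PA (π s) s' + ε * Q s (π s) s') * rS s' := by
          simp only [Finset.sum_mul]
      _ = ∑ s, ∑ s', m s * (PA (π s) s' + ε * Q s (π s) s') * rS s' := Finset.sum_comm
      _ = _ := by
          refine Finset.sum_congr rfl fun s _ => ?_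
          rw [Finset.mul_sum, ← Finset.sum_add_distrib, Finset.mul_sum]
          exact Finset.sum_congr rfl fun s' _ => by ring
  have e1 : ∑ s, m s * (rS s + rA (π s) + ε * rE s (π s)) =
      ∑ s, m s * rS s + ∑ s, m s * (rA (π s) + ε * rE s (π s)) := by
    rw [← Finset.sum_add_distrib]
    exact Finset.sum_congr rfl fun s _ => by ring
  rw [e1, key, ← Finset.sum_add_distrib]
  exact Finset.sum_congr rfl fun s _ => by ring

/-- **Theorem 2: the constant policy `π* ≡ a*` is `O(ε)`-optimal in the
ε-perturbed nearly separable MDP.** -/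
theorem nearly_separable_constant_policy_eps_optimal
    {S A : Type} [Fintype S] [DecidableEq S] [Nonempty S] [Fintype A] [Nonempty A]
    (rS : S → ℝ) (rA : A → ℝ) (PA : A → S → ℝ)
    (hPA : ∀ a, (∀ s', 0 ≤ PA a s') ∧ ∑ s', PA a s' = 1)
    (rE : S → A → ℝ) (Q : S → A → S → ℝ)
    (hQ0 : ∀ s a, ∑ s', Q s a s' = 0)
    (hQpos : ∀ s a s', PA a s' = 0 → 0 ≤ Q s a s')
    (hirr : ∀ π : S → A, IrreducibleMat (Matrix.of fun s s' => PA (π s) s'))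
    (μ : A → S → ℝ)
    (hinv : ∀ a, InvariantDist (μ a) (Matrix.of fun _ s' => PA a s'))
    (astar : A)
    (hastar : ∀ a, (∑ s, μ a s * rS s) + rA a ≤ (∑ s, μ astar s * rS s) + rA astar) :
    ∃ C > (0 : ℝ), ∃ ε₀ > (0 : ℝ), ∀ ε : ℝ, 0 ≤ ε → ε < ε₀ →
      (∀ π : S → A,
        RowStochastic (Matrix.of fun s s' => PA (π s) s' + ε * Q s (π s) s')) ∧
      (∀ (π : S → A) (μ' ν : S → ℝ),
        InvariantDist μ' (Matrix.of fun s s' => PA (π s) s' + ε * Q s (π s) s') →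
        InvariantDist ν (Matrix.of fun s s' => PA astar s' + ε * Q s astar s') →
        ∑ s, μ' s * (rS s + rA (π s) + ε * rE s (π s)) ≤
          (∑ s, ν s * (rS s + rA astar + ε * rE s astar)) + C * ε) := by
  have hμ : ∀ a s, μ a s = PA a s := by
    intro a s
    have h := (hinv a).2.2 s
    simp only [Matrix.of_apply] at h
    rw [← Finset.sum_mul, (hinv a).2.1, one_mul] at h
    exact h.symm
  simp only [hμ] at hastar
  obtain ⟨ε₀, hε₀, hnn⟩ : ∃ ε₀ > (0 : ℝ), ∀ ε : ℝ, 0 ≤ ε → ε < ε₀ →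
      ∀ s a s', 0 ≤ PA a s' + ε * Q s a s' := by
    have hev : ∀ᶠ ε in nhdsWithin (0 : ℝ) (Set.Ici 0),
        ∀ s a s', 0 ≤ PA a s' + ε * Q s a s' := by
      simp only [Filter.eventually_all]
      intro s a s'
      rcases ((hPA a).1 s').eq_or_lt with h0 | hpos
      · filter_upwards [self_mem_nhdsWithin] with ε hε
        rw [← h0, zero_add]
        exact mul_nonneg hε (hQpos s a s' h0.symm)
      · have hc : Continuous fun ε : ℝ => PA a s' + ε * Q s a s' := by fun_prop
        have ht := (hc.tendsto 0).eventually (lt_mem_nhds (a := 0) (by simpa using hpos))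
        filter_upwards [nhdsWithin_le_nhds ht] with ε hε
        exact hε.le
    obtain ⟨u, hu, hsub⟩ := mem_nhdsGE_iff_exists_Ico_subset.1 hev
    exact ⟨u, hu, fun ε h0 h1 => hsub ⟨h0, h1⟩⟩
  set g : S → A → ℝ := fun s a => (∑ s', Q s a s' * rS s') + rE s a with hg
  set f : A → ℝ := fun a => (∑ s', PA a s' * rS s') + rA a with hf
  set M : ℝ := ∑ s, ∑ a, |g s a| with hM
  have hM0 : 0 ≤ M := Finset.sum_nonneg fun s _ => Finset.sum_nonneg fun a _ => abs_nonneg _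
  have hgM : ∀ s a, |g s a| ≤ M := fun s a =>
    (Finset.single_le_sum (f := fun a => |g s a|) (fun a _ => abs_nonneg _)
      (Finset.mem_univ a)).trans
    (Finset.single_le_sum (f := fun s => ∑ a, |g s a|)
      (fun s _ => Finset.sum_nonneg fun a _ => abs_nonneg _) (Finset.mem_univ s))
  refine ⟨2 * M + 1, by linarith, ε₀, hε₀, fun ε h0 h1 => ⟨fun π => ⟨fun s s' => ?_, fun s => ?_⟩, ?_⟩⟩
  · exact hnn ε h0 h1 s (π s) s'
  · simp only [Matrix.of_apply]
    rw [Finset.sum_add_distrib, ← Finset.mul_sum, hQ0, (hPA _).2]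
    ring
  · intro π m ν hm hν
    rw [nsep_rewrite rS rA PA rE Q ε π m hm,
      nsep_rewrite rS rA PA rE Q ε (fun _ => astar) ν hν]
    have u1 : ∑ s, m s * (f (π s) + ε * g s (π s)) ≤ ∑ s, m s * (f astar + ε * M) := by
      refine Finset.sum_le_sum fun s _ => mul_le_mul_of_nonneg_left ?_ (hm.1 s)
      exact add_le_add (hastar (π s))
        (mul_le_mul_of_nonneg_left ((le_abs_self _).trans (hgM _ _)) h0)
    have u2 : ∑ s, ν s * (f astar + ε * (-M)) ≤ ∑ s, ν s * (f astar + ε * g s astar) := by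
      refine Finset.sum_le_sum fun s _ => mul_le_mul_of_nonneg_left ?_ (hν.1 s)
      exact add_le_add le_rfl
        (mul_le_mul_of_nonneg_left (neg_le_of_abs_le (hgM _ _)) h0)
    rw [← Finset.sum_mul, hm.2.1] at u1
    rw [← Finset.sum_mul, hν.2.1] at u2
    change ∑ s, m s * (f (π s) + ε * g s (π s)) ≤
      ∑ s, ν s * (f astar + ε * g s astar) + (2 * M + 1) * ε
    linarith
end

section
/- Let S be a finite nonempty set, P an irreducible row-stochastic matrix on S with invariant distribution μ₀, and Q : S × S → ℝ a matrix with Σ_{s'} Q(s,s') = 0 for all s and Q(s,s') ≥ 0 whenever P(s,s') = 0. Then the invariant distribution admits a regular first-order expansion: there exist a vector v : S → ℝ and constants C > 0 and ε₀ > 0 such that for all ε with 0 ≤ ε < ε₀, the matrix P + εQ is row-stochastic and every invariant distribution μ_ε of P + εQ satisfies max_s | μ_ε(s) − μ₀(s) − ε·v(s) | ≤ C·ε². -/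
open Finset

open Matrix in
lemma aux_pow_nonneg {S : Type} [Fintype S] [DecidableEq S] (P : Matrix S S ℝ)
    (h : ∀ s s', 0 ≤ P s s') (n : ℕ) : ∀ s s', 0 ≤ (P ^ n) s s' := by
  induction n with
  | zero =>
    intro s s'
    rw [pow_zero, Matrix.one_apply]
    split_ifs <;> norm_num
  | succ k ih =>
    intro s s'
    rw [pow_succ, Matrix.mul_apply]
    exact Finset.sum_nonneg fun t _ => mul_nonneg (ih _ _) (h _ _)

open Matrix in
lemma aux_pow_fix {S : Type} [Fintype S] [DecidableEq S] (P : Matrix S S ℝ)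
    (h : S → ℝ) (hh : P *ᵥ h = h) (n : ℕ) : (P ^ n) *ᵥ h = h := by
  induction n with
  | zero => simp
  | succ k ih => rw [pow_succ, ← Matrix.mulVec_mulVec, hh, ih]

open Matrix in
lemma aux_harmonic {S : Type} [Fintype S] [DecidableEq S] [Nonempty S] (P : Matrix S S ℝ)
    (hP : RowStochastic P) (hirr : IrreducibleMat P) (h : S → ℝ) (hh : P *ᵥ h = h) :
    ∃ c, ∀ s, h s = c := by
  obtain ⟨m, hm⟩ := Finite.exists_max h
  refine ⟨h m, fun t => ?_⟩
  obtain ⟨n, -, hn⟩ := hirr m t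
  have h1 : (P ^ n) *ᵥ (fun _ => (1 : ℝ)) = fun _ => 1 := by
    apply aux_pow_fix
    ext s
    simp [Matrix.mulVec, dotProduct, hP.2 s]
  have e1 := congrFun h1 m
  have e2 := congrFun (aux_pow_fix P h hh n) m
  simp only [Matrix.mulVec, dotProduct, mul_one] at e1 e2
  have e3 : ∑ u, (P ^ n) m u * (h m - h u) = 0 := by
    simp only [mul_sub, Finset.sum_sub_distrib, ← Finset.sum_mul, e1, e2]
    ring
  have e4 := (Finset.sum_eq_zero_iff_of_nonneg (fun u _ =>
    mul_nonneg (aux_pow_nonneg P hP.1 n m u) (sub_nonneg.2 (hm u)))).1 e3 t (Finset.mem_univ _)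
  rcases mul_eq_zero.1 e4 with e | e
  · exact absurd e hn.ne'
  · linarith

open Matrix in
lemma aux_unit {S : Type} [Fintype S] [DecidableEq S] [Nonempty S] (P : Matrix S S ℝ)
    (hP : RowStochastic P) (hirr : IrreducibleMat P) :
    IsUnit (1 - P + Matrix.of (fun _ _ => (1 : ℝ)) : Matrix S S ℝ) := by
  rw [← Matrix.mulVec_injective_iff_isUnit]
  have key : ∀ h : S → ℝ, (1 - P + Matrix.of (fun _ _ => (1 : ℝ)) : Matrix S S ℝ) *ᵥ h = 0 →
      h = 0 := by
    intro h hh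
    have e : ∀ s, h s - ∑ t, P s t * h t + ∑ t, h t = 0 := by
      intro s
      have := congrFun hh s
      rw [Matrix.add_mulVec, Matrix.sub_mulVec, Matrix.one_mulVec] at this
      simpa [Matrix.mulVec, dotProduct] using this
    have rs : ∀ s, ∑ t, P s t * (h s - h t) = h s - ∑ t, P s t * h t := by
      intro s
      simp only [mul_sub, Finset.sum_sub_distrib, ← Finset.sum_mul, hP.2 s]
      ring
    obtain ⟨m, hm⟩ := Finite.exists_max h
    obtain ⟨k, hk⟩ := Finite.exists_min h
    have h1 : 0 ≤ ∑ t, P m t * (h m - h t) :=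
      Finset.sum_nonneg fun t _ => mul_nonneg (hP.1 _ _) (sub_nonneg.2 (hm t))
    have h2 : ∑ t, P k t * (h k - h t) ≤ 0 :=
      Finset.sum_nonpos fun t _ => mul_nonpos_of_nonneg_of_nonpos (hP.1 _ _) (sub_nonpos.2 (hk t))
    have c0 : ∑ t, h t = 0 := by
      have := e m
      have := e k
      rw [rs] at h1 h2
      linarith
    obtain ⟨c, hc⟩ := aux_harmonic P hP hirr h (by
      ext s
      have := e s
      simp only [Matrix.mulVec, dotProduct]
      linarith)
    simp only [hc, Finset.sum_const, nsmul_eq_mul, mul_eq_zero] at c0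
    have : c = 0 := by
      rcases c0 with c0 | c0
      · simp at c0
      · exact c0
    ext s
    simp [hc, this]
  intro x y hxy
  have := key (x - y) (by
    have : (1 - P + Matrix.of (fun _ _ => (1 : ℝ)) : Matrix S S ℝ) *ᵥ x = (1 - P + Matrix.of (fun _ _ => (1 : ℝ)) : Matrix S S ℝ) *ᵥ y := hxy
    rw [Matrix.mulVec_sub, this, sub_self])
  exact sub_eq_zero.1 this

lemma aux_eps {S : Type} [Fintype S] (P Q : Matrix S S ℝ)
    (hP : ∀ s s', 0 ≤ P s s') (hQpos : ∀ s s', P s s' = 0 → 0 ≤ Q s s') :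
    ∃ ε₀ > (0 : ℝ), ∀ ε : ℝ, 0 ≤ ε → ε < ε₀ → ∀ s s', 0 ≤ P s s' + ε * Q s s' := by
  have : ∀ᶠ ε in nhdsWithin (0 : ℝ) (Set.Ici 0), ∀ s s', 0 ≤ P s s' + ε * Q s s' := by
    rw [Filter.eventually_all]
    intro s
    rw [Filter.eventually_all]
    intro s'
    rcases (hP s s').eq_or_lt with h | h
    · filter_upwards [self_mem_nhdsWithin] with ε hε
      rw [← h, zero_add]
      exact mul_nonneg hε (hQpos s s' h.symm)
    · apply nhdsWithin_le_nhds
      have hc : ContinuousAt (fun ε : ℝ => P s s' + ε * Q s s') 0 := by fun_prop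
      have := hc.eventually (lt_mem_nhds (a := 0) (by simpa using h))
      filter_upwards [this] with ε hε using hε.le
  obtain ⟨u, hu, hs⟩ := mem_nhdsGE_iff_exists_Ico_subset.1 this
  exact ⟨u, hu, fun ε h0 h1 => hs ⟨h0, h1⟩⟩

/-- **First-order expansion of the invariant distribution** of the perturbed
matrix `P + εQ`: `μ_ε = μ₀ + ε v + O(ε²)` uniformly in the state. -/
theorem invariant_distribution_first_order_expansion
    {S : Type} [Fintype S] [DecidableEq S] [Nonempty S]
    (P Q : Matrix S S ℝ) (μ₀ : S → ℝ)
    (hP : RowStochastic P) (hirr : IrreducibleMat P) (hinv : InvariantDist μ₀ P)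
    (hQ0 : ∀ s, ∑ s', Q s s' = 0) (hQpos : ∀ s s', P s s' = 0 → 0 ≤ Q s s') :
    ∃ v : S → ℝ, ∃ C > (0 : ℝ), ∃ ε₀ > (0 : ℝ), ∀ ε : ℝ, 0 ≤ ε → ε < ε₀ →
      RowStochastic (P + ε • Q) ∧
      ∀ με : S → ℝ, InvariantDist με (P + ε • Q) →
        ∀ s, |με s - μ₀ s - ε * v s| ≤ C * ε ^ 2 := by
  obtain ⟨ε₀, hε₀, hpos⟩ := aux_eps P Q hP.1 hQpos
  set A : Matrix S S ℝ := 1 - P + Matrix.of (fun _ _ => (1 : ℝ)) with hA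
  have hu : IsUnit A.det := (Matrix.isUnit_iff_isUnit_det A).1 (aux_unit P hP hirr)
  set M : Matrix S S ℝ := Q * A⁻¹ with hM
  have key : ∀ (ε : ℝ) (x : S → ℝ), InvariantDist x (P + ε • Q) →
      x - μ₀ = ε • Matrix.vecMul x M := by
    intro ε x hx
    have e1 : Matrix.vecMul (x - μ₀) A = ε • Matrix.vecMul x Q := by
      ext s
      have a1 := hx.2.2 s
      have a2 := hinv.2.2 s
      have b1 := hx.2.1
      have b2 := hinv.2.1
      rw [hA, Matrix.vecMul_add, Matrix.vecMul_sub, Matrix.vecMul_one, Matrix.sub_vecMul]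
      simp only [Matrix.add_apply, Matrix.smul_apply, smul_eq_mul, mul_add,
        Finset.sum_add_distrib] at a1
      simp only [Matrix.vecMul, dotProduct, Pi.add_apply, Pi.sub_apply, Pi.smul_apply, smul_eq_mul,
        Matrix.of_apply, mul_one, Finset.sum_sub_distrib, Finset.mul_sum]
      have a3 : ∑ t, x t * (ε * Q t s) = ∑ t, ε * (x t * Q t s) :=
        Finset.sum_congr rfl fun t _ => by ring
      linarith
    have e2 : Matrix.vecMul (Matrix.vecMul (x - μ₀) A) A⁻¹ = x - μ₀ := by
      rw [Matrix.vecMul_vecMul, Matrix.mul_nonsing_inv A hu, Matrix.vecMul_one]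
    rw [← e2, e1, Matrix.smul_vecMul, Matrix.vecMul_vecMul]
  refine ⟨Matrix.vecMul μ₀ M, ∑ s, ∑ t, |(M * M) t s| + 1, by positivity, ε₀, hε₀, ?_⟩
  intro ε h0 h1
  refine ⟨⟨fun s s' => by simpa using hpos ε h0 h1 s s', fun s => ?_⟩, fun x hx s => ?_⟩
  · simp [Finset.sum_add_distrib, ← Finset.mul_sum, hP.2 s, hQ0 s]
  · have k := key ε x hx
    have e : x - μ₀ - ε • Matrix.vecMul μ₀ M = (ε ^ 2) • Matrix.vecMul x (M * M) := by
      have : x - μ₀ - ε • Matrix.vecMul μ₀ M = ε • Matrix.vecMul (x - μ₀) M := by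
        rw [Matrix.sub_vecMul, smul_sub, ← k]
      rw [this, k, Matrix.smul_vecMul, Matrix.vecMul_vecMul, smul_smul, sq]
    have es := congrFun e s
    simp only [Pi.sub_apply, Pi.smul_apply, smul_eq_mul] at es
    rw [es, abs_mul, abs_of_nonneg (sq_nonneg ε), mul_comm]
    refine mul_le_mul_of_nonneg_right ?_ (sq_nonneg ε)
    have x1 : ∀ t, x t ≤ 1 := fun t => by
      rw [← hx.2.1]
      exact Finset.single_le_sum (fun i _ => hx.1 i) (Finset.mem_univ t)
    have b1 : |Matrix.vecMul x (M * M) s| ≤ ∑ t, |(M * M) t s| := by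
      simp only [Matrix.vecMul, dotProduct]
      refine (Finset.abs_sum_le_sum_abs _ _).trans (Finset.sum_le_sum fun t _ => ?_)
      rw [abs_mul, abs_of_nonneg (hx.1 t)]
      exact mul_le_of_le_one_left (abs_nonneg _) (x1 t)
    have b2 : ∑ t, |(M * M) t s| ≤ ∑ s, ∑ t, |(M * M) t s| :=
      Finset.single_le_sum (f := fun s => ∑ t, |(M * M) t s|)
        (fun i _ => Finset.sum_nonneg fun _ _ => abs_nonneg _) (Finset.mem_univ s)
    linarith
end

section
/- Consider an ε-perturbed nearly separable MDP in which the unperturbed induced matrix P_π^0 is irreducible for every stationary policy π, and for each a ∈ A the constant-policy matrix P_a has invariant distribution μ_a. Let g* = max_{a∈A} [Σ_s μ_a(s) r_S(s) + r_A(a)]. Then there exist constants C > 0 and ε₀ > 0 such that for all ε with 0 ≤ ε < ε₀, every stationary policy π, and every invariant distribution μ of the perturbed matrix P_π^ε, one has Σ_s μ(s) r^ε(s, π(s)) ≤ g* + C·ε; that is, the optimal average reward of the perturbed MDP exceeds the unperturbed optimal average reward g* by at most C·ε. -/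
open Finset

/-- **Upper bound on the optimal average reward of the perturbed MDP**: it
exceeds the unperturbed optimal value `g*` by at most `C·ε`. -/
theorem nearly_separable_optimal_value_upper_bound
    {S A : Type} [Fintype S] [DecidableEq S] [Nonempty S] [Fintype A] [Nonempty A]
    (rS : S → ℝ) (rA : A → ℝ) (PA : A → S → ℝ)
    (hPA : ∀ a, (∀ s', 0 ≤ PA a s') ∧ ∑ s', PA a s' = 1)
    (rE : S → A → ℝ) (Q : S → A → S → ℝ)
    (hQ0 : ∀ s a, ∑ s', Q s a s' = 0)
    (hQpos : ∀ s a s', PA a s' = 0 → 0 ≤ Q s a s')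
    (hirr : ∀ π : S → A, IrreducibleMat (Matrix.of fun s s' => PA (π s) s'))
    (μ : A → S → ℝ)
    (hinv : ∀ a, InvariantDist (μ a) (Matrix.of fun _ s' => PA a s')) :
    ∃ C > (0 : ℝ), ∃ ε₀ > (0 : ℝ), ∀ ε : ℝ, 0 ≤ ε → ε < ε₀ →
      ∀ (π : S → A) (ν : S → ℝ),
        InvariantDist ν (Matrix.of fun s s' => PA (π s) s' + ε * Q s (π s) s') →
        ∑ s, ν s * (rS s + rA (π s) + ε * rE s (π s)) ≤
          (Finset.univ.sup' Finset.univ_nonempty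
            (fun a => (∑ s, μ a s * rS s) + rA a)) + C * ε := by
  have hμ : ∀ a s', μ a s' = PA a s' := by
    intro a s'
    obtain ⟨_, h1, h2⟩ := hinv a
    have h := h2 s'
    simp only [Matrix.of_apply] at h
    rw [← Finset.sum_mul, h1, one_mul] at h
    exact h.symm
  set K : S → A → ℝ := fun s a => (∑ s', Q s a s' * rS s') + rE s a with hK
  have hKle : ∀ s a, K s a ≤ (∑ s, ∑ a, |K s a|) + 1 := by
    intro s a
    have h1 : |K s a| ≤ ∑ a, |K s a| :=
      Finset.single_le_sum (f := fun a => |K s a|) (fun _ _ => abs_nonneg _) (Finset.mem_univ a)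
    have h2 : ∑ a, |K s a| ≤ ∑ s, ∑ a, |K s a| :=
      Finset.single_le_sum (f := fun s => ∑ a, |K s a|)
        (fun _ _ => Finset.sum_nonneg fun _ _ => abs_nonneg _) (Finset.mem_univ s)
    linarith [le_abs_self (K s a)]
  refine ⟨(∑ s, ∑ a, |K s a|) + 1, ?_, 1, one_pos, ?_⟩
  · have : 0 ≤ ∑ s, ∑ a, |K s a| :=
      Finset.sum_nonneg fun _ _ => Finset.sum_nonneg fun _ _ => abs_nonneg _
    linarith
  intro ε hε _ π ν hν
  obtain ⟨h0, h1, h2⟩ := hν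
  simp only [Matrix.of_apply] at h2
  have key : ∑ s, ν s * rS s
      = ∑ s, ν s * ((∑ s', PA (π s) s' * rS s') + ε * ∑ s', Q s (π s) s' * rS s') := by
    calc ∑ s, ν s * rS s
        = ∑ s', ∑ s, ν s * (PA (π s) s' + ε * Q s (π s) s') * rS s' := by
          refine Finset.sum_congr rfl fun s' _ => ?_
          rw [← Finset.sum_mul, h2]
      _ = _ := by
          rw [Finset.sum_comm]
          refine Finset.sum_congr rfl fun s _ => ?_
          rw [Finset.mul_sum, ← Finset.sum_add_distrib, Finset.mul_sum]
          refine Finset.sum_congr rfl fun s' _ => ?_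
          ring
  have e : ∑ s, ν s * (rS s + rA (π s) + ε * rE s (π s))
      = ∑ s, ν s * (((∑ s', μ (π s) s' * rS s') + rA (π s)) + ε * K s (π s)) := by
    have : ∑ s, ν s * (rS s + rA (π s) + ε * rE s (π s))
      = ∑ s, ν s * rS s + ∑ s, ν s * (rA (π s) + ε * rE s (π s)) := by
      rw [← Finset.sum_add_distrib]
      exact Finset.sum_congr rfl fun s _ => by ring
    rw [this, key, ← Finset.sum_add_distrib]
    refine Finset.sum_congr rfl fun s _ => ?_
    simp only [hK, hμ]
    ring
  rw [e]
  set g := Finset.univ.sup' Finset.univ_nonempty (fun a => (∑ s, μ a s * rS s) + rA a) with hg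
  have hle : ∀ a, (∑ s, μ a s * rS s) + rA a ≤ g := fun a =>
    Finset.le_sup' (fun a => (∑ s, μ a s * rS s) + rA a) (Finset.mem_univ a)
  calc _ ≤ ∑ s, ν s * (g + ((∑ s, ∑ a, |K s a|) + 1) * ε) := by
        refine Finset.sum_le_sum fun s _ => mul_le_mul_of_nonneg_left ?_ (h0 s)
        have := mul_le_mul_of_nonneg_left (hKle s (π s)) hε
        linarith [hle (π s)]
    _ = _ := by rw [← Finset.sum_mul, h1, one_mul]
end

section
/- Consider an ε-perturbed nearly separable MDP in which the unperturbed induced matrix P_π^0 is irreducible for every stationary policy π, and for each a ∈ A the constant-policy matrix P_a has invariant distribution μ_a. Let a* maximize a ↦ Σ_s μ_a(s) r_S(s) + r_A(a) over A, let g* denote this maximum value, and let π* be the constant policy π*(s) = a*. Then there exist constants C > 0 and ε₀ > 0 such that for all ε with 0 ≤ ε < ε₀ and every invariant distribution ν of the perturbed matrix P_{π*}^ε, one has Σ_s ν(s) r^ε(s, a*) ≥ g* − C·ε. -/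
open Finset

/-- **Lower bound on the performance of the constant policy `π* ≡ a*`** in the
ε-perturbed MDP: its average reward is at least `g* − C·ε`. -/
theorem nearly_separable_constant_policy_lower_bound
    {S A : Type} [Fintype S] [DecidableEq S] [Nonempty S] [Fintype A] [Nonempty A]
    (rS : S → ℝ) (rA : A → ℝ) (PA : A → S → ℝ)
    (hPA : ∀ a, (∀ s', 0 ≤ PA a s') ∧ ∑ s', PA a s' = 1)
    (rE : S → A → ℝ) (Q : S → A → S → ℝ)
    (hQ0 : ∀ s a, ∑ s', Q s a s' = 0)
    (hQpos : ∀ s a s', PA a s' = 0 → 0 ≤ Q s a s')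
    (hirr : ∀ π : S → A, IrreducibleMat (Matrix.of fun s s' => PA (π s) s'))
    (μ : A → S → ℝ)
    (hinv : ∀ a, InvariantDist (μ a) (Matrix.of fun _ s' => PA a s'))
    (astar : A)
    (hastar : ∀ a, (∑ s, μ a s * rS s) + rA a ≤ (∑ s, μ astar s * rS s) + rA astar) :
    ∃ C > (0 : ℝ), ∃ ε₀ > (0 : ℝ), ∀ ε : ℝ, 0 ≤ ε → ε < ε₀ →
      ∀ ν : S → ℝ,
        InvariantDist ν (Matrix.of fun s s' => PA astar s' + ε * Q s astar s') →
        ∑ s, ν s * (rS s + rA astar + ε * rE s astar) ≥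
          ((∑ s, μ astar s * rS s) + rA astar) - C * ε := by
  have hμ : ∀ s', μ astar s' = PA astar s' := by
    intro s'
    obtain ⟨_, h1, h2⟩ := hinv astar
    have h := h2 s'
    simp only [Matrix.of_apply] at h
    rw [← Finset.sum_mul, h1, one_mul] at h
    exact h.symm
  refine ⟨1 + ∑ s, |∑ s', Q s astar s' * rS s' + rE s astar|, ?_, 1, one_pos, ?_⟩
  · have : 0 ≤ ∑ s, |∑ s', Q s astar s' * rS s' + rE s astar| :=
      Finset.sum_nonneg fun _ _ => abs_nonneg _
    linarith
  intro ε hε _ ν hν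
  obtain ⟨h0, h1, h2⟩ := hν
  simp only [Matrix.of_apply] at h2
  have h3 : ∀ s', ν s' = PA astar s' + ε * ∑ s, ν s * Q s astar s' := by
    intro s'
    rw [← h2 s']
    simp only [mul_add, Finset.sum_add_distrib]
    rw [← Finset.sum_mul, h1, one_mul, Finset.mul_sum]
    congr 1
    exact Finset.sum_congr rfl fun _ _ => by ring
  have h4 : ∑ s, ν s * rS s = ∑ s, μ astar s * rS s
      + ε * ∑ s, ν s * ∑ s', Q s astar s' * rS s' := by
    have e : ∑ s, ν s * ∑ s', Q s astar s' * rS s'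
        = ∑ s', (∑ s, ν s * Q s astar s') * rS s' := by
      simp only [Finset.mul_sum, Finset.sum_mul]
      rw [Finset.sum_comm]
      exact Finset.sum_congr rfl fun _ _ => Finset.sum_congr rfl fun _ _ => by ring
    rw [e, Finset.mul_sum, ← Finset.sum_add_distrib]
    refine Finset.sum_congr rfl fun s _ => ?_
    rw [hμ s]
    conv_lhs => rw [h3 s]
    ring
  have h5 : ∑ s, ν s * (rS s + rA astar + ε * rE s astar)
      = (∑ s, μ astar s * rS s) + rA astar
        + ε * ∑ s, ν s * (∑ s', Q s astar s' * rS s' + rE s astar) := by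
    have e1 : ∑ s, ν s * (rS s + rA astar + ε * rE s astar)
        = ∑ s, ν s * rS s + (∑ s, ν s) * rA astar + ε * ∑ s, ν s * rE s astar := by
      rw [Finset.sum_mul, Finset.mul_sum, ← Finset.sum_add_distrib, ← Finset.sum_add_distrib]
      exact Finset.sum_congr rfl fun _ _ => by ring
    have e2 : ∑ s, ν s * (∑ s', Q s astar s' * rS s' + rE s astar)
        = ∑ s, ν s * ∑ s', Q s astar s' * rS s' + ∑ s, ν s * rE s astar := by
      rw [← Finset.sum_add_distrib]
      exact Finset.sum_congr rfl fun _ _ => by ring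
    rw [e1, e2, h4, h1]
    ring
  have h6 : -∑ s, |∑ s', Q s astar s' * rS s' + rE s astar|
      ≤ ∑ s, ν s * (∑ s', Q s astar s' * rS s' + rE s astar) := by
    rw [← Finset.sum_neg_distrib]
    refine Finset.sum_le_sum fun s _ => ?_
    have hle : ν s ≤ 1 := by
      rw [← h1]
      exact Finset.single_le_sum (fun i _ => h0 i) (Finset.mem_univ s)
    have ha := neg_abs_le (∑ s', Q s astar s' * rS s' + rE s astar)
    have hb := abs_nonneg (∑ s', Q s astar s' * rS s' + rE s astar)
    have hc := h0 s
    nlinarith [mul_le_mul_of_nonneg_left ha hc, mul_le_mul_of_nonneg_right hle hb]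
  rw [h5]
  have h7 := mul_le_mul_of_nonneg_left h6 hε
  linarith
end
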